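/- The graph F(9,14,19), defined as the simple graph on vertex set {1,...,9} with edge set {{1,4},{2,4},{2,5},{1,5},{3,6},{2,6},{2,7},{3,7},{4,6},{5,7},{1,8},{3,8},{8,9},{2,9}}, is forbidden: there is no injective map φ : {1,...,9} → ℝ² with dist(φ(i), φ(j)) = 1 for every edge {i,j}. -/

import Mathlib

lemma dist_one_iff (A B : EuclideanSpace ℝ (Fin 2)) :
    dist A B = 1 ↔ (A 0 - B 0)^2 + (A 1 - B 1)^2 = 1 := by
  rw [EuclideanSpace.dist_eq, Real.sqrt_eq_one, Fin.sum_univ_two, Real.dist_eq, Real.dist_eq,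
    sq_abs, sq_abs]

lemma orth_zero (u v a b x y : ℝ) (h : ¬ (a = 0 ∧ b = 0)) (h' : ¬ (x = 0 ∧ y = 0))
    (h1 : u * a + v * b = 0) (h2 : u * x + v * y = 0) (h3 : a * x + b * y = 0) :
    u = 0 ∧ v = 0 := by
  have ha : 0 < a^2 + b^2 := by
    by_contra hc
    exact h ⟨by nlinarith [sq_nonneg a, sq_nonneg b], by nlinarith [sq_nonneg a, sq_nonneg b]⟩
  have hx : 0 < x^2 + y^2 := by
    by_contra hc
    exact h' ⟨by nlinarith [sq_nonneg x, sq_nonneg y], by nlinarith [sq_nonneg x, sq_nonneg y]⟩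
  have hd : (a * y - b * x)^2 = (a^2+b^2) * (x^2+y^2) := by
    linear_combination (-(a * x + b * y)) * h3
  have hd0 : a * y - b * x ≠ 0 := by
    intro h0
    rw [h0] at hd
    have := mul_pos ha hx
    linarith
  constructor
  · apply (mul_eq_zero.1 (_ : (a * y - b * x) * u = 0)).resolve_left hd0
    linear_combination y * h1 - b * h2
  · apply (mul_eq_zero.1 (_ : (a * y - b * x) * v = 0)).resolve_left hd0
    linear_combination a * h2 - x * h1

lemma rhombus (P Q X Y : EuclideanSpace ℝ (Fin 2)) (hPQ : P ≠ Q) (hXY : X ≠ Y)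
    (h1 : dist P X = 1) (h2 : dist P Y = 1) (h3 : dist Q X = 1) (h4 : dist Q Y = 1) :
    X + Y = P + Q := by
  rw [dist_one_iff] at h1 h2 h3 h4
  have key := orth_zero (X 0 + Y 0 - P 0 - Q 0) (X 1 + Y 1 - P 1 - Q 1)
    (P 0 - Q 0) (P 1 - Q 1) (X 0 - Y 0) (X 1 - Y 1)
    (fun h => hPQ (by ext i; fin_cases i <;> simp <;> linarith [h.1, h.2]))
    (fun h => hXY (by ext i; fin_cases i <;> simp <;> linarith [h.1, h.2]))
    (by linarith) (by linarith) (by linarith)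
  ext i
  fin_cases i <;> simp <;> linarith [key.1, key.2]


theorem F_9_14_19_forbidden :
    ¬ ∃ φ : ℕ → EuclideanSpace ℝ (Fin 2),
      Set.InjOn φ (Set.Icc 1 9) ∧
      dist (φ 1) (φ 4) = 1 ∧
      dist (φ 2) (φ 4) = 1 ∧
      dist (φ 2) (φ 5) = 1 ∧
      dist (φ 1) (φ 5) = 1 ∧
      dist (φ 3) (φ 6) = 1 ∧
      dist (φ 2) (φ 6) = 1 ∧
      dist (φ 2) (φ 7) = 1 ∧
      dist (φ 3) (φ 7) = 1 ∧
      dist (φ 4) (φ 6) = 1 ∧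
      dist (φ 5) (φ 7) = 1 ∧
      dist (φ 1) (φ 8) = 1 ∧
      dist (φ 3) (φ 8) = 1 ∧
      dist (φ 8) (φ 9) = 1 ∧
      dist (φ 2) (φ 9) = 1 := by

  rintro ⟨φ, inj, h14, h24, h25, h15, h36, h26, h27, h37, h46, h57, h18, h38, h89, h29⟩
  have ne : ∀ i j : ℕ, 1 ≤ i → i ≤ 9 → 1 ≤ j → j ≤ 9 → i ≠ j → φ i ≠ φ j :=
    fun i j a b c d hij h => hij (inj ⟨a, b⟩ ⟨c, d⟩ h)
  have n13 := ne 1 3 (by simp) (by simp) (by simp) (by simp) (by simp)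
  have n12 := ne 1 2 (by simp) (by simp) (by simp) (by simp) (by simp)
  have n32 := ne 3 2 (by simp) (by simp) (by simp) (by simp) (by simp)
  have n45 := ne 4 5 (by simp) (by simp) (by simp) (by simp) (by simp)
  have n67 := ne 6 7 (by simp) (by simp) (by simp) (by simp) (by simp)
  have n82 := ne 8 2 (by simp) (by simp) (by simp) (by simp) (by simp)
  have n94 := ne 9 4 (by simp) (by simp) (by simp) (by simp) (by simp)
  have n97 := ne 9 7 (by simp) (by simp) (by simp) (by simp) (by simp)
  have n95 := ne 9 5 (by simp) (by simp) (by simp) (by simp) (by simp)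
  have n96 := ne 9 6 (by simp) (by simp) (by simp) (by simp) (by simp)
  have r1 := rhombus _ _ _ _ n12 n45 h14 h15 h24 h25
  have r2 := rhombus _ _ _ _ n32 n67 h36 h37 h26 h27
  have e1 : φ 1 = φ 4 + φ 5 - φ 2 := by rw [r1]; abel
  have e3 : φ 3 = φ 6 + φ 7 - φ 2 := by rw [r2]; abel
  have fin : ∀ i j : ℕ, φ 9 ≠ φ i → φ 9 ≠ φ j → dist (φ 2) (φ i) = 1 →
      dist (φ 2) (φ j) = 1 → φ 8 = φ i + φ j - φ 2 → False := by
    intro i j hi hj di dj h8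
    have d : dist (φ 8) (φ i) = 1 := by
      rw [h8, ← dj, dist_comm (φ 2), dist_eq_norm, dist_eq_norm]
      congr 1; abel
    have r := rhombus _ _ _ _ n82 hi h89 d h29 di
    apply hj
    rw [h8] at r
    have : φ 9 + φ i = φ j + φ i := by rw [r]; abel
    exact add_right_cancel this
  by_cases h : φ 8 = φ 4 + φ 7 - φ 2
  · exact fin 4 7 n94 n97 h24 h27 h
  · have d1 : dist (φ 1) (φ 4 + φ 7 - φ 2) = 1 := by
      rw [e1, ← h57, dist_eq_norm, dist_eq_norm]
      congr 1; abel
    have d3 : dist (φ 3) (φ 4 + φ 7 - φ 2) = 1 := by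
      rw [e3, ← h46, dist_comm (φ 4), dist_eq_norm, dist_eq_norm]
      congr 1; abel
    have r := rhombus _ _ _ _ n13 h h18 d1 h38 d3
    apply fin 5 6 n95 n96 h25 h26
    rw [eq_sub_of_add_eq r, e1, e3]
    abel
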